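/- Consider the Riemann setup: f_i ∈ C²(ℝ) for i = 1,…,n; g : ℝ → ℝ continuous, one-sided Lipschitz on every compact interval, with limsup_{η→±∞} g(η)/η < ∞; ū(t,s) the unique forward solution of dū/dt = g(ū), ū(0,s) = s; χ_i(t,s) := ∫₀^t f_i'(ū(τ,s)) dτ and χ(t,s) := (χ₁(t,s),…,χₙ(t,s)); M ∈ C¹(ℝⁿ); and Condition (H): for every x ∈ ℝⁿ with M(x) = 0 and every u ∈ (a,b), Σ_{i=1}^n ∂M/∂x_i(x) f_i''(u) > 0, where a ≤ inf_{t≥0} min{ū(t,u₋), ū(t,u₊)} and b ≥ sup_{t≥0} max{ū(t,u₋), ū(t,u₊)}. Suppose u₋ < u₊. Then for every (t,x) with t > 0 satisfying M(x − χ(t,u₋)) ≥ 0 and M(x − χ(t,u₊)) ≤ 0, there exists exactly one c ∈ [u₋, u₊] such that M(x − χ(t,c)) = 0. -/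

import Mathlib

open Set Filter MeasureTheory

noncomputable section

/-- Euclidean space `ℝⁿ`. -/
abbrev Euc (n : ℕ) := EuclideanSpace ℝ (Fin n)

/-- `u` is a forward solution on `[0,∞)` of the ODE `u' = g(u)` with `u(0) = s`. -/
def IsForwardSol (g : ℝ → ℝ) (s : ℝ) (u : ℝ → ℝ) : Prop :=
  u 0 = s ∧ ∀ t ∈ Set.Ici (0:ℝ), HasDerivWithinAt u (g (u t)) (Set.Ici 0) t

/-- `g` is one-sided (right-) Lipschitz on every compact interval. -/
def OSLCompact (g : ℝ → ℝ) : Prop :=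
  ∀ a b : ℝ, a < b → ∃ L : ℝ, ∀ w ∈ Set.Icc a b, ∀ z ∈ Set.Icc a b,
    w ≠ z → (g w - g z) / (w - z) ≤ L

/-- `limsup_{η → +∞} g(η)/η < ∞` and `limsup_{η → -∞} g(η)/η < ∞`. -/
def SublinearLimsup (g : ℝ → ℝ) : Prop :=
  (∃ C : ℝ, ∀ᶠ η in Filter.atTop, g η / η ≤ C) ∧
  (∃ C : ℝ, ∀ᶠ η in Filter.atBot, g η / η ≤ C)


lemma osl_compare (g : ℝ → ℝ) (u v : ℝ → ℝ) (s r : ℝ) (hu : IsForwardSol g s u)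
    (hv : IsForwardSol g r v) (T A B L : ℝ)
    (hL : ∀ w ∈ Set.Icc A B, ∀ z ∈ Set.Icc A B, w ≠ z → (g w - g z) / (w - z) ≤ L)
    (huT : ∀ t ∈ Set.Icc 0 T, u t ∈ Set.Icc A B) (hvT : ∀ t ∈ Set.Icc 0 T, v t ∈ Set.Icc A B)
    (δ : ℝ) (hδ : 0 < δ) (h0 : s - r ≤ δ) :
    ∀ t ∈ Set.Icc 0 T, u t - v t ≤ δ * Real.exp ((L + 1) * t) := by
  have hd : ∀ t ∈ Set.Ici (0:ℝ),
      HasDerivWithinAt (fun t => u t - v t) (g (u t) - g (v t)) (Set.Ici 0) t :=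
    fun t ht => (hu.2 t ht).sub (hv.2 t ht)
  have hB : ∀ t : ℝ, HasDerivAt (fun t => δ * Real.exp ((L + 1) * t))
      (δ * (Real.exp ((L + 1) * t) * (L + 1))) t := by
    intro t
    have h1 : HasDerivAt (fun t : ℝ => (L + 1) * t) (L + 1) t := by
      simpa using (hasDerivAt_id t).const_mul (L + 1)
    exact (h1.exp).const_mul δ
  intro t ht
  refine image_le_of_deriv_right_lt_deriv_boundary (f := fun t => u t - v t)
    (f' := fun t => g (u t) - g (v t)) (a := 0) (b := T) ?_ ?_ ?_ hB ?_ ht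
  · intro x hx
    exact ((hd x hx.1).continuousWithinAt).mono Icc_subset_Ici_self
  · intro x hx
    exact (hd x hx.1).mono (Ici_subset_Ici.2 hx.1)
  · simpa [hu.1, hv.1] using h0
  · intro x hx heq
    have hx' : x ∈ Icc 0 T := ⟨hx.1, hx.2.le⟩
    have hpos : 0 < δ * Real.exp ((L + 1) * x) := by positivity
    have heq' : u x - v x = δ * Real.exp ((L + 1) * x) := heq
    have hp : 0 < u x - v x := heq' ▸ hpos
    have := hL _ (huT x hx') _ (hvT x hx') (sub_ne_zero.1 hp.ne')
    rw [div_le_iff₀ hp] at this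
    have e : δ * (Real.exp ((L + 1) * x) * (L + 1)) = (L + 1) * (u x - v x) := by
      rw [heq']; ring
    rw [e]
    show g (u x) - g (v x) < _
    linarith

lemma sol_cont {g : ℝ → ℝ} {s : ℝ} {u : ℝ → ℝ} (hu : IsForwardSol g s u) :
    ContinuousOn u (Set.Ici 0) := fun t ht => (hu.2 t ht).continuousWithinAt

lemma sol_mono (g : ℝ → ℝ) (hOSL : OSLCompact g) (u v : ℝ → ℝ) (s r : ℝ)
    (hu : IsForwardSol g s u) (hv : IsForwardSol g r v) (hsr : s ≤ r) (T : ℝ) (hT : 0 ≤ T) :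
    u T ≤ v T := by
  obtain ⟨A₁, hA₁⟩ := (isCompact_Icc.image_of_continuousOn
    ((sol_cont hu).mono ((Icc_subset_Ici_self : Icc 0 T ⊆ Ici 0)))).isBounded.bddBelow
  obtain ⟨A₂, hA₂⟩ := (isCompact_Icc.image_of_continuousOn
    ((sol_cont hv).mono ((Icc_subset_Ici_self : Icc 0 T ⊆ Ici 0)))).isBounded.bddBelow
  obtain ⟨B₁, hB₁⟩ := (isCompact_Icc.image_of_continuousOn
    ((sol_cont hu).mono ((Icc_subset_Ici_self : Icc 0 T ⊆ Ici 0)))).isBounded.bddAbove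
  obtain ⟨B₂, hB₂⟩ := (isCompact_Icc.image_of_continuousOn
    ((sol_cont hv).mono ((Icc_subset_Ici_self : Icc 0 T ⊆ Ici 0)))).isBounded.bddAbove
  have h1 : ∀ t ∈ Icc 0 T, u t ∈ Icc (min A₁ A₂) (max B₁ B₂ + 1) := fun t ht =>
    ⟨(min_le_left _ _).trans (hA₁ (mem_image_of_mem u ht)),
      (hB₁ (mem_image_of_mem u ht)).trans (by linarith [le_max_left B₁ B₂])⟩
  have h2 : ∀ t ∈ Icc 0 T, v t ∈ Icc (min A₁ A₂) (max B₁ B₂ + 1) := fun t ht =>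
    ⟨(min_le_right _ _).trans (hA₂ (mem_image_of_mem v ht)),
      (hB₂ (mem_image_of_mem v ht)).trans (by linarith [le_max_right B₁ B₂])⟩
  have hT' : T ∈ Icc 0 T := ⟨hT, le_rfl⟩
  have hlt : min A₁ A₂ < max B₁ B₂ + 1 := by
    have a1 := hA₁ (mem_image_of_mem u hT')
    have a2 := hB₁ (mem_image_of_mem u hT')
    linarith [min_le_left A₁ A₂, le_max_left B₁ B₂]
  obtain ⟨L, hL⟩ := hOSL _ _ hlt
  by_contra! hcon
  have hE := Real.exp_pos ((L + 1) * T)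
  have hq : 0 < (u T - v T) / (2 * Real.exp ((L + 1) * T)) :=
    div_pos (by linarith) (by linarith)
  have := osl_compare g u v s r hu hv T _ _ L hL h1 h2 _ hq (by linarith) T hT'
  have e : (u T - v T) / (2 * Real.exp ((L + 1) * T)) * Real.exp ((L + 1) * T)
      = (u T - v T) / 2 := by field_simp
  rw [e] at this
  linarith

/-- If every zero of `ψ` has negative derivative and `ψ 0 = 0` then `ψ 1 < 0`. -/
lemma neg_of_zero_deriv (ψ ψ' : ℝ → ℝ) (h : ∀ s, HasDerivAt ψ (ψ' s) s)
    (hz : ∀ s, ψ s = 0 → ψ' s < 0) (h0 : ψ 0 = 0) : ψ 1 < 0 := by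
  have hc : Continuous ψ := continuous_iff_continuousAt.2 fun s => (h s).continuousAt
  have hle : ∀ s ∈ Icc (0:ℝ) 1, ψ s ≤ 0 := by
    intro s hs
    exact image_le_of_deriv_right_lt_deriv_boundary (f := ψ) (f' := ψ') (a := 0) (b := 1)
      (B := fun _ => 0) (B' := fun _ => 0) hc.continuousOn
      (fun x _ => (h x).hasDerivWithinAt) h0.le (fun x => hasDerivAt_const x 0)
      (fun x _ hx => hz x hx) hs
  rcases (hle 1 (by simp)).lt_or_eq with h1 | h1
  · exact h1
  exfalso
  have hs := (hasDerivAt_iff_tendsto_slope.1 (h 1)).eventually (gt_mem_nhds (hz 1 h1))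
  have hs' : ∀ᶠ y in nhdsWithin (1:ℝ) (Iio 1), slope ψ 1 y < 0 :=
    hs.filter_mono (nhdsWithin_mono _ (fun y hy => ne_of_lt hy))
  have hI : ∀ᶠ y in nhdsWithin (1:ℝ) (Iio 1), y ∈ Ioo (0:ℝ) 1 :=
    Ioo_mem_nhdsLT (by norm_num)
  obtain ⟨y, hy, hy'⟩ := (hs'.and hI).exists
  rw [slope_def_field, h1] at hy
  have := hle y ⟨hy'.1.le, hy'.2.le⟩
  have : 0 ≤ (ψ y - 0) / (y - 1) :=
    div_nonneg_of_nonpos (by linarith) (by linarith [hy'.2])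
  linarith

/-- unique solvability of the rarefaction-wave equation (6.18) of the
paper.  In the Riemann setup with Condition (H) and `u₋ < u₊`, for every `(t,x)` with
`t > 0`, `M(x - χ(t,u₋)) ≥ 0` and `M(x - χ(t,u₊)) ≤ 0`, there is exactly one
`c ∈ [u₋, u₊]` with `M(x - χ(t,c)) = 0`. -/
theorem riemann_rarefaction_unique_root
    (n : ℕ) (hn : 1 ≤ n)
    (f : Fin n → ℝ → ℝ) (hf : ∀ i, ContDiff ℝ 2 (f i))
    (g : ℝ → ℝ) (hg : Continuous g) (hOSL : OSLCompact g) (hsub : SublinearLimsup g)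
    (ub : ℝ → ℝ → ℝ) (hub : ∀ s : ℝ, IsForwardSol g s (fun t => ub t s))
    (χ : ℝ → ℝ → Euc n)
    (hχ : ∀ t s : ℝ, χ t s = (EuclideanSpace.equiv (Fin n) ℝ).symm
      (fun i => ∫ τ in (0:ℝ)..t, deriv (f i) (ub τ s)))
    (M : Euc n → ℝ) (hM : ContDiff ℝ 1 M)
    (uminus uplus a b : ℝ)
    (ha : ∀ t : ℝ, 0 ≤ t → a ≤ min (ub t uminus) (ub t uplus))
    (hb : ∀ t : ℝ, 0 ≤ t → max (ub t uminus) (ub t uplus) ≤ b)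
    (hH : ∀ x : Euc n, M x = 0 → ∀ w ∈ Set.Ioo a b,
      0 < ∑ i, fderiv ℝ M x (EuclideanSpace.single i 1) * deriv (deriv (f i)) w)
    (hu : uminus < uplus) :
    ∀ t : ℝ, ∀ x : Euc n, 0 < t →
      0 ≤ M (x - χ t uminus) → M (x - χ t uplus) ≤ 0 →
      ∃! c : ℝ, c ∈ Set.Icc uminus uplus ∧ M (x - χ t c) = 0 := by
  intro t x ht h0 h1
  have hsol0 : ∀ s, ub 0 s = s := fun s => (hub s).1
  have hmono : ∀ τ, 0 ≤ τ → ∀ s r, s ≤ r → ub τ s ≤ ub τ r := fun τ hτ s r hsr =>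
    sol_mono g hOSL _ _ s r (hub s) (hub r) hsr τ hτ
  have hrange : ∀ s ∈ Icc uminus uplus, ∀ τ, 0 ≤ τ → ub τ s ∈ Icc a b := fun s hs τ hτ =>
    ⟨((ha τ hτ).trans (min_le_left _ _)).trans (hmono τ hτ _ _ hs.1),
      (hmono τ hτ _ _ hs.2).trans ((le_max_right _ _).trans (hb τ hτ))⟩
  have hab : a < b := by
    have e1 := (hrange uminus ⟨le_rfl, hu.le⟩ 0 le_rfl).1
    have e2 := (hrange uplus ⟨hu.le, le_rfl⟩ 0 le_rfl).2
    rw [hsol0] at e1 e2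
    linarith
  have hfd : ∀ i, ContDiff ℝ 1 (deriv (f i)) := fun i => by
    have := hf i
    rw [show (2 : WithTop ℕ∞) = 1 + 1 by norm_num, contDiff_succ_iff_deriv] at this
    exact this.2.2
  have hfc : ∀ i, Continuous (deriv (f i)) := fun i => (hfd i).continuous
  have hcontτ : ∀ i s, ContinuousOn (fun τ => deriv (f i) (ub τ s)) (Icc 0 t) := fun i s =>
    (hfc i).comp_continuousOn ((sol_cont (hub s)).mono Icc_subset_Ici_self)
  have hint : ∀ i s, IntervalIntegrable (fun τ => deriv (f i) (ub τ s)) volume 0 t :=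
    fun i s => (by rw [← uIcc_of_le ht.le] at hcontτ; exact (hcontτ i s).intervalIntegrable)
  obtain ⟨L, hL⟩ := hOSL a b hab
  -- continuity in the initial datum
  have hcs : ∀ τ, 0 ≤ τ → ContinuousOn (fun s => ub τ s) (Icc uminus uplus) := by
    intro τ hτ
    rw [Metric.continuousOn_iff]
    intro s hs ε hε
    have hE := Real.exp_pos ((L + 1) * τ)
    have key : ∀ p ∈ Icc uminus uplus, ∀ q ∈ Icc uminus uplus,
        |p - q| < ε / 2 / Real.exp ((L + 1) * τ) → ub τ p - ub τ q ≤ ε / 2 := by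
      intro p hp q hq hpq
      have := osl_compare g _ _ p q (hub p) (hub q) τ a b L hL
        (fun t' ht' => hrange p hp t' ht'.1) (fun t' ht' => hrange q hq t' ht'.1)
        (ε / 2 / Real.exp ((L + 1) * τ)) (by positivity) ((le_abs_self _).trans hpq.le)
        τ ⟨hτ, le_rfl⟩
      rwa [div_mul_cancel₀ _ hE.ne'] at this
    refine ⟨ε / 2 / Real.exp ((L + 1) * τ), by positivity, fun r hr hrs => ?_⟩
    rw [Real.dist_eq] at hrs ⊢
    have k1 := key r hr s hs hrs
    have k2 := key s hs r hr (by rwa [abs_sub_comm])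
    rw [abs_lt]
    constructor <;> linarith
  have hcχi : ∀ i, ContinuousOn (fun s => ∫ τ in (0:ℝ)..t, deriv (f i) (ub τ s))
      (Icc uminus uplus) := by
    intro i s hs
    obtain ⟨C, hC⟩ := (isCompact_Icc (a := a) (b := b)).exists_bound_of_continuousOn
      (hfc i).continuousOn
    refine intervalIntegral.continuousWithinAt_of_dominated_interval (bound := fun _ => C)
      ?_ ?_ ?_ ?_
    · exact Eventually.of_forall fun r => ((hint i r).def').aestronglyMeasurable
    · filter_upwards [self_mem_nhdsWithin] with r hr
      refine Eventually.of_forall fun τ hτ => ?_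
      rw [uIoc_of_le ht.le] at hτ
      exact hC _ (hrange r hr τ hτ.1.le)
    · exact intervalIntegrable_const
    · refine Eventually.of_forall fun τ hτ => ?_
      rw [uIoc_of_le ht.le] at hτ
      exact ((hfc i).continuousAt).comp_continuousWithinAt (hcs τ hτ.1.le s hs)
  have hcχ : ContinuousOn (fun s => χ t s) (Icc uminus uplus) := by
    simp only [hχ]
    exact (EuclideanSpace.equiv (Fin n) ℝ).symm.continuous.comp_continuousOn
      (continuousOn_pi.2 hcχi)
  have hcφ : ContinuousOn (fun c => M (x - χ t c)) (Icc uminus uplus) :=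
    hM.continuous.comp_continuousOn (continuousOn_const.sub hcχ)
  -- strict decrease past a zero
  have hMd : Differentiable ℝ M := hM.differentiable (by norm_num)
  have hdir : ∀ c ∈ Icc uminus uplus, ∀ c' ∈ Icc uminus uplus, c < c' → ∀ z, M z = 0 →
      0 < fderiv ℝ M z (χ t c' - χ t c) := by
    intro c hc c' hc' hcc z hz
    set m : Fin n → ℝ := fun i => fderiv ℝ M z (EuclideanSpace.single i 1) with hm
    have hlin : ∀ v : Euc n, fderiv ℝ M z v = ∑ i, m i * v i := by
      intro v
      have hv : v = ∑ i, v i • (EuclideanSpace.single i (1:ℝ) : Euc n) := by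
        have := (EuclideanSpace.basisFun (Fin n) ℝ).sum_repr v
        simpa using this.symm
      conv_lhs => rw [hv]
      rw [map_sum]
      refine Finset.sum_congr rfl fun i _ => ?_
      rw [map_smul, smul_eq_mul, mul_comm]
    have hcoord : ∀ s i, (χ t s) i = ∫ τ in (0:ℝ)..t, deriv (f i) (ub τ s) := by
      intro s i
      rw [hχ]; rfl
    set H : ℝ → ℝ := fun w => ∑ i, m i * deriv (f i) w with hH'
    have hHc : Continuous H := continuous_finset_sum _ fun i _ => continuous_const.mul (hfc i)
    have hHd : ∀ w, HasDerivAt H (∑ i, m i * deriv (deriv (f i)) w) w := by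
      intro w
      refine HasDerivAt.fun_sum fun i _ => ?_
      exact (((hfd i).differentiable (by norm_num) w).hasDerivAt).const_mul (m i)
    have hHm : StrictMonoOn H (Icc a b) := by
      refine strictMonoOn_of_deriv_pos (convex_Icc a b) hHc.continuousOn fun w hw => ?_
      rw [interior_Icc] at hw
      rw [(hHd w).deriv]
      exact hH z hz w hw
    have heq : fderiv ℝ M z (χ t c' - χ t c)
        = ∫ τ in (0:ℝ)..t, (H (ub τ c') - H (ub τ c)) := by
      rw [hlin]
      have : ∀ τ, H (ub τ c') - H (ub τ c)
          = ∑ i, m i * (deriv (f i) (ub τ c') - deriv (f i) (ub τ c)) := by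
        intro τ
        simp only [hH', mul_sub, Finset.sum_sub_distrib]
      simp only [this]
      rw [intervalIntegral.integral_finset_sum
        (fun i _ => ((hint i c').sub (hint i c)).const_mul (m i))]
      refine Finset.sum_congr rfl fun i _ => ?_
      rw [intervalIntegral.integral_const_mul,
        intervalIntegral.integral_sub (hint i c') (hint i c), ← hcoord, ← hcoord]
      rfl
    rw [heq]
    have hci : ∀ s, ContinuousOn (fun τ => H (ub τ s)) (Icc 0 t) := fun s =>
      hHc.comp_continuousOn ((sol_cont (hub s)).mono Icc_subset_Ici_self)
    refine intervalIntegral.integral_pos ht ((hci c').sub (hci c)) ?_ ⟨0, ⟨le_rfl, ht.le⟩, ?_⟩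
    · intro τ hτ
      exact sub_nonneg.2 (hHm.monotoneOn (hrange c hc τ hτ.1.le) (hrange c' hc' τ hτ.1.le)
        (hmono τ hτ.1.le _ _ hcc.le))
    · refine sub_pos.2 (hHm (hrange c hc 0 le_rfl) (hrange c' hc' 0 le_rfl) ?_)
      rwa [hsol0, hsol0]
  have hstrict : ∀ c ∈ Icc uminus uplus, ∀ c' ∈ Icc uminus uplus, c < c' →
      M (x - χ t c) = 0 → M (x - χ t c') < 0 := by
    intro c hc c' hc' hcc h
    set v := χ t c' - χ t c with hv
    have := neg_of_zero_deriv (fun s => M (x - χ t c - s • v))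
      (fun s => fderiv ℝ M (x - χ t c - s • v) (-v)) ?_ ?_ ?_
    · have e : x - χ t c - (1:ℝ) • v = x - χ t c' := by rw [hv, one_smul]; abel
      simpa only [e] using this
    · intro s
      have h1 : HasDerivAt (fun s : ℝ => x - χ t c - s • v) (-v) s := by
        simpa using ((hasDerivAt_id s).smul_const v).const_sub (x - χ t c)
      exact (hMd _).hasFDerivAt.comp_hasDerivAt s h1
    · intro s hs
      have := hdir c hc c' hc' hcc _ hs
      show fderiv ℝ M (x - χ t c - s • v) (-v) < 0
      rw [map_neg]
      linarith
    · simpa using h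
  obtain ⟨c, hc, hc0⟩ := intermediate_value_Icc' hu.le hcφ ⟨h1, h0⟩
  refine ⟨c, ⟨hc, hc0⟩, ?_⟩
  rintro d ⟨hd, hd0⟩
  rcases lt_trichotomy d c with h | h | h
  · exact absurd hc0 (hstrict d hd c hc h hd0).ne
  · exact h
  · exact absurd hd0 (hstrict c hc d hd h hc0).ne
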